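/- arXiv:2211.03302 — 2 statements merged into one kernel-verified Lean document; each statement's English description precedes it below -/
import Mathlib

section
/- (Properness of the truncated scoring mechanism) Let Ψ ⊆ [n] satisfy Σ_{i∈Ψ} c_i ≤ 3/2 and 2c_i ≤ p_i ≤ 1 for all i ∈ Ψ. Define single-dimensional rules S_i(⊥, ω_i) = 9c_i/(8p_i) and S_i(σ_i, ω_i) = (9c_i/(4p_i))·1{σ_i = ω_i} for σ_i ∈ {0,1}, the shift d = −11/2 + (9/8)·Σ_{i∈Ψ} c_i/p_i, and the truncated separate scoring rule S(σ, ω) = min{11, max{0, −d + Σ_{i∈Ψ} S_i(σ_i, ω_i)}}. Then S is proper: for every signal profile σ and every alternative report σ', the expectation of S(σ, ω) under the posterior induced by σ is at least the expectation of S(σ', ω) under that posterior. -/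
open Finset

namespace KS

abbrev Sig (n : ℕ) := Fin n → Option Bool
abbrev St (n : ℕ) := Fin n → Bool

/-- Posterior probability of state profile `ω` induced by signal profile `σ`:
`ω i = b` with probability 1 when `σ i = some b`, uniform when `σ i = none`. -/
noncomputable def postProb {n : ℕ} (σ : Sig n) (ω : St n) : ℝ :=
  ∏ i, (σ i).elim ((1:ℝ)/2) (fun b => if ω i = b then 1 else 0)

/-- Expectation of `f` over states, under the posterior induced by `σ`. -/
noncomputable def postExp {n : ℕ} (σ : Sig n) (f : St n → ℝ) : ℝ :=
  ∑ ω : St n, postProb σ ω * f ω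

/-- A scoring rule is proper if truthful reporting of the signal maximizes the
expected score under the induced posterior. -/
def Proper {n : ℕ} (S : Sig n → St n → ℝ) : Prop :=
  ∀ σ σ' : Sig n, postExp σ (S σ) ≥ postExp σ (S σ')

/-- Probability of receiving signal profile `σ` when exerting effort exactly on `Ψ`
(with state-revelation probabilities `p`, states uniform and independent). -/
noncomputable def sigProb {n : ℕ} (p : Fin n → ℝ) (Ψ : Finset (Fin n)) (σ : Sig n) : ℝ :=
  ∏ i, if i ∈ Ψ then (σ i).elim (1 - p i) (fun _ => p i / 2)
       else (σ i).elim 1 (fun _ => 0)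

/-- Expected score `E_{σ∼Ψ}[E_{ω∼σ}[S(σ,ω)]]` for exerting effort on `Ψ` and
truthfully reporting. -/
noncomputable def expScore {n : ℕ} (p : Fin n → ℝ) (Ψ : Finset (Fin n))
    (S : Sig n → St n → ℝ) : ℝ :=
  ∑ σ : Sig n, sigProb p Ψ σ * postExp σ (S σ)

/-- Incentive compatibility of the mechanism `(S, Ψ)`. -/
def IC {n : ℕ} (p c : Fin n → ℝ) (S : Sig n → St n → ℝ) (Ψ : Finset (Fin n)) : Prop :=
  Proper S ∧ ∀ Ψ' : Finset (Fin n),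
    expScore p Ψ S - ∑ i ∈ Ψ, c i ≥ expScore p Ψ' S - ∑ i ∈ Ψ', c i

/-- Truncated separate scoring rule with budget `B`. -/
def IsTruncSep {n : ℕ} (B : ℝ) (S : Sig n → St n → ℝ) : Prop :=
  ∃ (T : Fin n → Option Bool → Bool → ℝ) (d : ℝ),
    ∀ σ ω, S σ ω = min B (max 0 (-d + ∑ i, T i (σ i) (ω i)))

open Classical in
/-- Threshold scoring rule with recommendation set `Ψ` and threshold `η`. -/
noncomputable def thresholdScore {n : ℕ} (Ψ : Finset (Fin n)) (η : ℕ)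
    (σ : Sig n) (ω : St n) : ℝ :=
  if ∃ i ∈ Ψ, σ i ≠ none ∧ σ i ≠ some (ω i) then 0
  else if η ≤ (Ψ.filter fun i => σ i = some (ω i)).card then 1
  else (1/2 : ℝ) ^ (η - (Ψ.filter fun i => σ i = some (ω i)).card)

def IsThreshold {n : ℕ} (S : Sig n → St n → ℝ) : Prop :=
  ∃ (Ψ : Finset (Fin n)) (η : ℕ), ∀ σ ω, S σ ω = thresholdScore Ψ η σ ω

end KS

namespace KS

/-- Flip the states of the tasks on which the signal `σ` is uninformative. -/
def flipUnknown {n : ℕ} (σ : Sig n) (ω : St n) : St n :=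
  fun i => (σ i).elim (!ω i) (fun _ => ω i)

theorem flipUnknown_involutive {n : ℕ} (σ : Sig n) :
    Function.Involutive (flipUnknown σ) := by
  intro ω
  funext i
  cases h : σ i <;> simp [flipUnknown, h]

theorem postProb_flipUnknown {n : ℕ} (σ : Sig n) (ω : St n) :
    postProb σ (flipUnknown σ ω) = postProb σ ω := by
  refine Finset.prod_congr rfl fun i _ => ?_
  cases h : σ i <;> simp [flipUnknown, h]

theorem postProb_nonneg {n : ℕ} (σ : Sig n) (ω : St n) : 0 ≤ postProb σ ω := by
  refine Finset.prod_nonneg fun i _ => ?_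
  cases σ i with
  | none => norm_num
  | some b => simp only [Option.elim]; split_ifs <;> norm_num

theorem eq_of_postProb_ne_zero {n : ℕ} {σ : Sig n} {ω : St n} (h : postProb σ ω ≠ 0)
    {i : Fin n} {b : Bool} (hi : σ i = some b) : ω i = b := by
  have := Finset.prod_ne_zero_iff.mp h i (Finset.mem_univ i)
  simpa [hi] using this

theorem postExp_comp_flipUnknown {n : ℕ} (σ : Sig n) (f : St n → ℝ) :
    postExp σ (fun ω => f (flipUnknown σ ω)) = postExp σ f := by
  unfold postExp
  rw [← Equiv.sum_comp (flipUnknown_involutive σ).toPerm (fun ω => postProb σ ω * f ω)]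
  simp [postProb_flipUnknown]

/-- Expectations are comparable as soon as the symmetrizations under `flipUnknown` are
comparable on the support of the posterior. -/
theorem postExp_le_of_add_flipUnknown_le {n : ℕ} {σ : Sig n} {f g : St n → ℝ}
    (h : ∀ ω, postProb σ ω ≠ 0 →
      f ω + f (flipUnknown σ ω) ≤ g ω + g (flipUnknown σ ω)) :
    postExp σ f ≤ postExp σ g := by
  have key : postExp σ f + postExp σ (fun ω => f (flipUnknown σ ω)) ≤
      postExp σ g + postExp σ (fun ω => g (flipUnknown σ ω)) := by
    simp only [postExp, ← Finset.sum_add_distrib, ← mul_add]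
    refine Finset.sum_le_sum fun ω _ => ?_
    by_cases h0 : postProb σ ω = 0
    · simp [h0]
    · exact mul_le_mul_of_nonneg_left (h ω h0) (postProb_nonneg σ ω)
  rw [postExp_comp_flipUnknown, postExp_comp_flipUnknown] at key
  linarith

/-- Truncation to `[0, B]` satisfies the midpoint concavity inequality at every point above
the centre `B / 2`. -/
theorem clamp_add_clamp_le {B a u v : ℝ} (hB : 0 ≤ B) (ha : B / 2 ≤ a)
    (huv : u + v ≤ 2 * a) :
    min B (max 0 u) + min B (max 0 v) ≤ 2 * min B (max 0 a) := by
  rcases min_cases B (max 0 u) with h1 | h1 <;> rcases max_cases 0 u with h2 | h2 <;>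
  rcases min_cases B (max 0 v) with h3 | h3 <;> rcases max_cases 0 v with h4 | h4 <;>
  rcases min_cases B (max 0 a) with h5 | h5 <;> rcases max_cases 0 a with h6 | h6 <;>
  linarith

end KS

/-- Properness of the truncated scoring mechanism of Figure 1. -/
theorem stmt5 {n : ℕ} (p c : Fin n → ℝ) (Ψ : Finset (Fin n))
    (hc : ∀ i ∈ Ψ, 0 < c i) (hcp : ∀ i ∈ Ψ, 2 * c i ≤ p i) (hp1 : ∀ i ∈ Ψ, p i ≤ 1)
    (hsum : ∑ i ∈ Ψ, c i ≤ 3/2)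
    (T : Fin n → Option Bool → Bool → ℝ)
    (hT : ∀ i σi ωi, T i σi ωi =
      σi.elim (9 * c i / (8 * p i)) (fun b => if b = ωi then 9 * c i / (4 * p i) else 0))
    (d : ℝ) (hd : d = -(11/2) + (9/8) * ∑ i ∈ Ψ, c i / p i)
    (S : KS.Sig n → KS.St n → ℝ)
    (hS : ∀ σ ω, S σ ω = min 11 (max 0 (-d + ∑ i ∈ Ψ, T i (σ i) (ω i)))) :
    KS.Proper S := by
  intro σ σ'
  refine KS.postExp_le_of_add_flipUnknown_le fun ω hω => ?_
  have hr : ∀ i ∈ Ψ, 0 ≤ 9 * c i / (8 * p i) := fun i hi => by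
    have h1 := hc i hi
    have h2 := hcp i hi
    have : 0 < p i := by linarith
    positivity
  have hdouble : ∀ i, 9 * c i / (4 * p i) = 2 * (9 * c i / (8 * p i)) := fun i => by
    rw [show 8 * p i = 2 * (4 * p i) by ring, ← div_div]
    ring
  have hknown : ∀ i b, σ i = some b → ω i = b := fun i b hi =>
    KS.eq_of_postProb_ne_zero hω hi
  have hflip : ∑ i ∈ Ψ, T i (σ i) (KS.flipUnknown σ ω i) = ∑ i ∈ Ψ, T i (σ i) (ω i) := by
    refine Finset.sum_congr rfl fun i _ => ?_
    cases h : σ i <;> simp [hT, KS.flipUnknown, h]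
  have htruth : ∑ i ∈ Ψ, 9 * c i / (8 * p i) ≤ ∑ i ∈ Ψ, T i (σ i) (ω i) := by
    refine Finset.sum_le_sum fun i hi => ?_
    have h0 := hr i hi
    cases h : σ i with
    | none => simp [hT]
    | some b =>
      simp only [hT, Option.elim, hknown i b h, if_true, hdouble]
      linarith
  have hdev : ∑ i ∈ Ψ, T i (σ' i) (ω i) + ∑ i ∈ Ψ, T i (σ' i) (KS.flipUnknown σ ω i) ≤
      2 * ∑ i ∈ Ψ, T i (σ i) (ω i) := by
    rw [← Finset.sum_add_distrib, Finset.mul_sum]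
    refine Finset.sum_le_sum fun i hi => ?_
    have h0 := hr i hi
    cases h : σ i with
    | none =>
      cases σ' i with
      | none => simp only [hT, Option.elim]; linarith
      | some b' =>
        cases b' <;> cases h' : ω i <;>
          simp [hT, KS.flipUnknown, h, h', hdouble]
    | some b =>
      have hb := hknown i b h
      cases σ' i with
      | none =>
        simp only [hT, Option.elim, hb, if_true, hdouble]
        linarith
      | some b' =>
        simp only [hT, Option.elim, KS.flipUnknown, h, hb, if_true, hdouble]
        split_ifs <;> linarith
  have hd' : -d = 11 / 2 - ∑ i ∈ Ψ, 9 * c i / (8 * p i) := by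
    have : ∑ i ∈ Ψ, 9 * c i / (8 * p i) = (9 / 8) * ∑ i ∈ Ψ, c i / p i := by
      rw [Finset.mul_sum]
      exact Finset.sum_congr rfl fun i _ => mul_div_mul_comm _ _ _ _
    rw [this, hd]
    ring
  simp only [hS, hflip]
  rw [← two_mul]
  exact KS.clamp_add_clamp_le (by norm_num) (by linarith) (by linarith)
end

section
/- (Properness of the threshold scoring rule) For every recommendation set Ψ ⊆ [n] and every threshold η ≥ 0, the threshold scoring rule with set Ψ and threshold η is proper: for every signal profile σ ∈ {0,1,⊥}^n and every alternative report σ', the expectation of the score of the truthful report σ under the posterior induced by σ is at least the expectation of the score of σ' under that posterior. -/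
open Finset

namespace KS

/-- The signal profile `σ` agrees with the state `ω` wherever it is informative on `Ψ`. -/
def Consistent {n : ℕ} (Ψ : Finset (Fin n)) (σ : Sig n) (ω : St n) : Prop :=
  ∀ i ∈ Ψ, ∀ b, σ i = some b → ω i = b

/-- The coordinates of the state are independent under the posterior. -/
lemma sum_postProb_mul_prod {n : ℕ} (σ : Sig n) (g : Fin n → Bool → ℝ) :
    ∑ ω : St n, postProb σ ω * ∏ i, g i (ω i) =
      ∏ i, ∑ b, (σ i).elim ((1 : ℝ) / 2) (fun a => if b = a then 1 else 0) * g i b := by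
  rw [Finset.prod_univ_sum, Fintype.piFinset_univ]
  simp only [postProb, Finset.prod_mul_distrib]

lemma sum_postProb {n : ℕ} (σ : Sig n) : ∑ ω : St n, postProb σ ω = 1 := by
  have h := sum_postProb_mul_prod σ (fun _ _ => 1)
  simp only [Finset.prod_const_one, mul_one] at h
  rw [h]
  refine Finset.prod_eq_one fun i _ => ?_
  cases σ i <;> simp

lemma consistent_of_postProb_ne_zero {n : ℕ} (Ψ : Finset (Fin n)) {σ : Sig n} {ω : St n}
    (h : postProb σ ω ≠ 0) : Consistent Ψ σ ω := by
  intro i _ b hb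
  have hi := Finset.prod_ne_zero_iff.mp h i (Finset.mem_univ i)
  by_contra hne
  simp [hb, hne] at hi

open Classical in
/-- A report scores according to the number of tasks of `Ψ` on which it is informative,
provided that it is consistent with the state. -/
lemma thresholdScore_eq {n : ℕ} (Ψ : Finset (Fin n)) (η : ℕ) (σ : Sig n) (ω : St n) :
    thresholdScore Ψ η σ ω =
      if Consistent Ψ σ ω then (1 / 2 : ℝ) ^ (η - #{i ∈ Ψ | σ i ≠ none}) else 0 := by
  unfold thresholdScore
  by_cases h : Consistent Ψ σ ω
  · have hno : ¬ ∃ i ∈ Ψ, σ i ≠ none ∧ σ i ≠ some (ω i) := by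
      rintro ⟨i, hi, hne, hcon⟩
      obtain ⟨b, hb⟩ := Option.ne_none_iff_exists'.mp hne
      exact hcon (by rw [hb, h i hi b hb])
    have hfilter : {i ∈ Ψ | σ i = some (ω i)} = {i ∈ Ψ | σ i ≠ none} := by
      refine Finset.filter_congr fun i hi => ⟨fun hs => by simp [hs], fun hne => ?_⟩
      by_contra hcon
      exact hno ⟨i, hi, hne, hcon⟩
    rw [if_neg hno, if_pos h, hfilter]
    split_ifs with hη
    · rw [Nat.sub_eq_zero_of_le hη, pow_zero]
    · rfl
  · rw [if_neg h, if_pos]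
    simp only [Consistent, not_forall] at h
    obtain ⟨i, hi, b, hb, hne⟩ := h
    exact ⟨i, hi, by simp [hb], by simpa [hb] using Ne.symm hne⟩

open Classical in
/-- Each informative report on a task with an uninformative signal is a fair coin flip. -/
lemma sum_postProb_consistent_le {n : ℕ} (Ψ : Finset (Fin n)) (σ σ' : Sig n) :
    ∑ ω : St n, postProb σ ω * (if Consistent Ψ σ' ω then 1 else 0) ≤
      (1 / 2 : ℝ) ^ #{i ∈ Ψ | σ' i ≠ none ∧ σ i = none} := by
  have hind (ω : St n) : (if Consistent Ψ σ' ω then (1 : ℝ) else 0) =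
      ∏ i, if i ∈ Ψ → ∀ b, σ' i = some b → ω i = b then 1 else 0 := by
    rw [Finset.prod_ite_zero]
    simp [Consistent]
  have hpow : (1 / 2 : ℝ) ^ #{i ∈ Ψ | σ' i ≠ none ∧ σ i = none} =
      ∏ i, if i ∈ Ψ ∧ σ' i ≠ none ∧ σ i = none then 1 / 2 else 1 := by
    rw [← Finset.prod_filter, Finset.prod_const]
    congr 2
    ext i
    simp
  simp only [hind]
  rw [sum_postProb_mul_prod σ
    (fun i a => if i ∈ Ψ → ∀ b, σ' i = some b → a = b then 1 else 0), hpow]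
  refine Finset.prod_le_prod (fun i _ => Finset.sum_nonneg fun b _ => ?_) fun i _ => ?_
  · cases σ i <;> simp only [Option.elim] <;> split_ifs <;> norm_num
  · by_cases hi : i ∈ Ψ <;> rcases hs : σ i with _ | _ | _ <;>
      rcases hs' : σ' i with _ | _ | _ <;> norm_num [hi] <;> split_ifs <;> simp_all
    norm_num

lemma card_informative_le {n : ℕ} (Ψ : Finset (Fin n)) (σ σ' : Sig n) :
    #{i ∈ Ψ | σ' i ≠ none} ≤
      #{i ∈ Ψ | σ i ≠ none} + #{i ∈ Ψ | σ' i ≠ none ∧ σ i = none} := by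
  refine (Finset.card_le_card fun i hi => ?_).trans (Finset.card_union_le _ _)
  simp only [Finset.mem_union, Finset.mem_filter] at hi ⊢
  tauto

lemma postExp_thresholdScore_self {n : ℕ} (Ψ : Finset (Fin n)) (η : ℕ) (σ : Sig n) :
    postExp σ (thresholdScore Ψ η σ) = (1 / 2 : ℝ) ^ (η - #{i ∈ Ψ | σ i ≠ none}) := by
  classical
  calc postExp σ (thresholdScore Ψ η σ)
      = ∑ ω : St n, postProb σ ω * (1 / 2 : ℝ) ^ (η - #{i ∈ Ψ | σ i ≠ none}) := by
        refine Finset.sum_congr rfl fun ω _ => ?_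
        by_cases h : postProb σ ω = 0
        · simp [h]
        · rw [thresholdScore_eq, if_pos (consistent_of_postProb_ne_zero Ψ h)]
    _ = _ := by rw [← Finset.sum_mul, sum_postProb, one_mul]

lemma postExp_thresholdScore_le {n : ℕ} (Ψ : Finset (Fin n)) (η : ℕ) (σ σ' : Sig n) :
    postExp σ (thresholdScore Ψ η σ') ≤
      (1 / 2 : ℝ) ^ (#{i ∈ Ψ | σ' i ≠ none ∧ σ i = none} + (η - #{i ∈ Ψ | σ' i ≠ none})) := by
  classical
  calc postExp σ (thresholdScore Ψ η σ')
      = (∑ ω : St n, postProb σ ω * (if Consistent Ψ σ' ω then 1 else 0)) *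
          (1 / 2 : ℝ) ^ (η - #{i ∈ Ψ | σ' i ≠ none}) := by
        rw [postExp, Finset.sum_mul]
        refine Finset.sum_congr rfl fun ω _ => ?_
        rw [thresholdScore_eq]
        split_ifs <;> simp
    _ ≤ _ := by
        rw [pow_add]
        refine mul_le_mul_of_nonneg_right ?_ (by positivity)
        convert sum_postProb_consistent_le Ψ σ σ'

end KS

/-- Properness of the threshold scoring rule, for every recommendation set `Ψ`
and threshold `η`. -/
theorem stmt14 {n : ℕ} (Ψ : Finset (Fin n)) (η : ℕ) :
    KS.Proper (KS.thresholdScore Ψ η) := by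
  intro σ σ'
  rw [KS.postExp_thresholdScore_self]
  refine (KS.postExp_thresholdScore_le Ψ η σ σ').trans
    (pow_le_pow_of_le_one (by norm_num) (by norm_num) ?_)
  have := KS.card_informative_le Ψ σ σ'
  omega
end
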